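/- arXiv:2602.08589 — 5 statements merged into one kernel-verified Lean document; each statement's English description precedes it below -/
import Mathlib

section
/- Let P be an n×n column-stochastic matrix that is time-reversible with respect to a probability vector π with strictly positive entries, let γ ∈ (0,1) and let v ∈ ℝⁿ have nonnegative entries summing to 1. Then the PageRank objective f(x) = (1/2)(1−γ) xᵀ Π⁻¹ (I − P) x + (γ/2) ‖Π^{−1/2}(x − v)‖₂² has a unique global minimizer over ℝⁿ, and this minimizer equals the PageRank vector p_o = γ (I − (1−γ)P)⁻¹ v, i.e. the unique solution of the linear system x = (1−γ) P x + γ v. -/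
open Matrix BigOperators

/-- The Dirichlet form of a column-stochastic matrix with stationary vector `π`. -/
theorem dirichlet_form_eq {ι : Type*} [Fintype ι] [DecidableEq ι] {P : Matrix ι ι ℝ}
    (hcol : ∀ j, ∑ i, P i j = 1) {π : ι → ℝ} (hπ : ∀ i, 0 < π i) (hstat : P *ᵥ π = π)
    (x : ι → ℝ) :
    x ⬝ᵥ (diagonal (fun i => (π i)⁻¹) * (1 - P)) *ᵥ x =
      (1 / 2) * ∑ i, ∑ j, P i j * π j * (x i / π i - x j / π j) ^ 2 := by
  have hne : ∀ i, π i ≠ 0 := fun i => (hπ i).ne'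
  have hdiag : ∑ i, ∑ j, P i j * π j * (x i / π i) ^ 2 = ∑ i, x i ^ 2 / π i := by
    refine Finset.sum_congr rfl fun i _ => ?_
    have h : ∑ j, P i j * π j = π i := congrFun hstat i
    rw [← Finset.sum_mul, h]
    field_simp [hne i]
  have hdiag' : ∑ i, ∑ j, P i j * (x j ^ 2 / π j) = ∑ i, x i ^ 2 / π i := by
    rw [Finset.sum_comm]
    refine Finset.sum_congr rfl fun j _ => ?_
    rw [← Finset.sum_mul, hcol j, one_mul]
  have hexpand : ∑ i, ∑ j, P i j * π j * (x i / π i - x j / π j) ^ 2 =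
      ∑ i, ∑ j, P i j * π j * (x i / π i) ^ 2 + ∑ i, ∑ j, P i j * (x j ^ 2 / π j)
        - 2 * ∑ i, ∑ j, x i * (π i)⁻¹ * (P i j * x j) := by
    simp only [Finset.mul_sum, ← Finset.sum_add_distrib, ← Finset.sum_sub_distrib]
    refine Finset.sum_congr rfl fun i _ => Finset.sum_congr rfl fun j _ => ?_
    have := hne i
    have := hne j
    field_simp
    ring
  have hform : x ⬝ᵥ (diagonal (fun i => (π i)⁻¹) * (1 - P)) *ᵥ x =
      ∑ i, x i ^ 2 / π i - ∑ i, ∑ j, x i * (π i)⁻¹ * (P i j * x j) := by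
    rw [← mulVec_mulVec, sub_mulVec, one_mulVec, dotProduct, ← Finset.sum_sub_distrib]
    refine Finset.sum_congr rfl fun i _ => ?_
    rw [mulVec_diagonal, ← Finset.mul_sum, Pi.sub_apply, mulVec, dotProduct]
    ring
  rw [hform, hexpand, hdiag, hdiag']
  ring

/-- The Dirichlet form of a column-stochastic matrix is nonnegative. -/
theorem dirichlet_form_nonneg {ι : Type*} [Fintype ι] [DecidableEq ι] {P : Matrix ι ι ℝ}
    (hnonneg : ∀ i j, 0 ≤ P i j) (hcol : ∀ j, ∑ i, P i j = 1) {π : ι → ℝ}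
    (hπ : ∀ i, 0 < π i) (hstat : P *ᵥ π = π) (x : ι → ℝ) :
    0 ≤ x ⬝ᵥ (diagonal (fun i => (π i)⁻¹) * (1 - P)) *ᵥ x := by
  rw [dirichlet_form_eq hcol hπ hstat]
  exact mul_nonneg (by norm_num) (Finset.sum_nonneg fun i _ => Finset.sum_nonneg fun j _ =>
    mul_nonneg (mul_nonneg (hnonneg i j) (hπ j).le) (sq_nonneg _))

/-- Time-reversibility makes the rescaled random-walk Laplacian symmetric. -/
theorem isSymm_rescaled_laplacian {ι : Type*} [Fintype ι] [DecidableEq ι] {P : Matrix ι ι ℝ}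
    {π : ι → ℝ} (hπ : ∀ i, 0 < π i)
    (hrev : Pᵀ = diagonal (fun i => (π i)⁻¹) * P * diagonal π) :
    (diagonal (fun i => (π i)⁻¹) * (1 - P)).IsSymm := by
  have hinv : diagonal π * diagonal (fun i => (π i)⁻¹) = (1 : Matrix ι ι ℝ) := by
    rw [diagonal_mul_diagonal, ← diagonal_one]
    exact congrArg diagonal (funext fun i => mul_inv_cancel₀ (hπ i).ne')
  rw [IsSymm, transpose_mul, diagonal_transpose, transpose_sub, transpose_one, hrev, sub_mul,
    mul_assoc, hinv, mul_one, one_mul, mul_sub, mul_one]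

/-- The weighted squared norm `∑ i, x i ^ 2 / π i` vanishes only at zero. -/
theorem eq_zero_of_weighted_sq_nonpos {ι : Type*} [Fintype ι] {π : ι → ℝ} (hπ : ∀ i, 0 < π i)
    {x : ι → ℝ} (hx : ∑ i, x i ^ 2 / π i ≤ 0) : x = 0 := by
  have hnonneg : ∀ i ∈ Finset.univ, 0 ≤ x i ^ 2 / π i := fun i _ =>
    div_nonneg (sq_nonneg _) (hπ i).le
  have hzero := (Finset.sum_eq_zero_iff_of_nonneg hnonneg).1
    (le_antisymm hx (Finset.sum_nonneg hnonneg))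
  funext i
  simpa [(hπ i).ne'] using hzero i (Finset.mem_univ i)

/-- The PageRank system matrix is invertible. -/
theorem isUnit_det_one_sub_smul {ι : Type*} [Fintype ι] [DecidableEq ι] {P : Matrix ι ι ℝ}
    (hnonneg : ∀ i j, 0 ≤ P i j) (hcol : ∀ j, ∑ i, P i j = 1) {π : ι → ℝ}
    (hπ : ∀ i, 0 < π i) (hstat : P *ᵥ π = π) {γ : ℝ} (hγ : γ ∈ Set.Ioo (0 : ℝ) 1) :
    IsUnit (1 - (1 - γ) • P).det := by
  rw [isUnit_iff_ne_zero]
  intro hdet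
  obtain ⟨x, hx, hker⟩ := exists_mulVec_eq_zero_iff.2 hdet
  refine hx (eq_zero_of_weighted_sq_nonpos hπ ?_)
  have hQ := dirichlet_form_nonneg hnonneg hcol hπ hstat x
  have hsum : (1 - γ) * (x ⬝ᵥ (diagonal (fun i => (π i)⁻¹) * (1 - P)) *ᵥ x) +
      γ * ∑ i, x i ^ 2 / π i = 0 := by
    rw [← mulVec_mulVec, sub_mulVec, one_mulVec, dotProduct, Finset.mul_sum, Finset.mul_sum,
      ← Finset.sum_add_distrib]
    refine Finset.sum_eq_zero fun i _ => ?_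
    have h : x i - (1 - γ) * (P *ᵥ x) i = 0 := by
      simpa [sub_mulVec, smul_mulVec] using congrFun hker i
    rw [mulVec_diagonal, Pi.sub_apply]
    linear_combination x i * (π i)⁻¹ * h
  nlinarith [hγ.1, mul_nonneg (sub_nonneg.2 hγ.2.le) hQ]

/-- Completing the square in the PageRank objective around a solution of the PageRank system. -/
theorem pagerank_objective_eq {ι : Type*} [Fintype ι] [DecidableEq ι] {P : Matrix ι ι ℝ}
    {π : ι → ℝ} (hπ : ∀ i, 0 < π i)
    (hrev : Pᵀ = diagonal (fun i => (π i)⁻¹) * P * diagonal π) {γ : ℝ} {v p : ι → ℝ}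
    (hp : p = (1 - γ) • P *ᵥ p + γ • v) (x : ι → ℝ) :
    (1 / 2) * (1 - γ) * (x ⬝ᵥ (diagonal (fun i => (π i)⁻¹) * (1 - P)) *ᵥ x)
        + (γ / 2) * ∑ i, (x i - v i) ^ 2 / π i =
      ((1 / 2) * (1 - γ) * (p ⬝ᵥ (diagonal (fun i => (π i)⁻¹) * (1 - P)) *ᵥ p)
        + (γ / 2) * ∑ i, (p i - v i) ^ 2 / π i) +
      ((1 / 2) * (1 - γ) * ((x - p) ⬝ᵥ (diagonal (fun i => (π i)⁻¹) * (1 - P)) *ᵥ (x - p))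
        + (γ / 2) * ∑ i, (x - p) i ^ 2 / π i) := by
  have hsymm := isSymm_rescaled_laplacian hπ hrev
  have hstationary : ∀ y : ι → ℝ,
      (1 - γ) * (y ⬝ᵥ (diagonal (fun i => (π i)⁻¹) * (1 - P)) *ᵥ p) +
        γ * ∑ i, y i * (p i - v i) / π i = 0 := by
    intro y
    rw [← mulVec_mulVec, sub_mulVec, one_mulVec, dotProduct, Finset.mul_sum, Finset.mul_sum,
      ← Finset.sum_add_distrib]
    refine Finset.sum_eq_zero fun i _ => ?_
    have h : p i = (1 - γ) * (P *ᵥ p) i + γ * v i := congrFun hp i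
    rw [mulVec_diagonal, Pi.sub_apply]
    linear_combination y i * (π i)⁻¹ * h
  have hswap : p ⬝ᵥ (diagonal (fun i => (π i)⁻¹) * (1 - P)) *ᵥ (x - p) =
      (x - p) ⬝ᵥ (diagonal (fun i => (π i)⁻¹) * (1 - P)) *ᵥ p := by
    rw [dotProduct_mulVec, ← mulVec_transpose, hsymm.eq, dotProduct_comm]
  have hsq : ∑ i, (x i - v i) ^ 2 / π i = ∑ i, (p i - v i) ^ 2 / π i +
      2 * ∑ i, (x - p) i * (p i - v i) / π i + ∑ i, (x - p) i ^ 2 / π i := by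
    rw [Finset.mul_sum, ← Finset.sum_add_distrib, ← Finset.sum_add_distrib]
    refine Finset.sum_congr rfl fun i _ => ?_
    rw [Pi.sub_apply]
    ring
  have hquad : x ⬝ᵥ (diagonal (fun i => (π i)⁻¹) * (1 - P)) *ᵥ x =
      p ⬝ᵥ (diagonal (fun i => (π i)⁻¹) * (1 - P)) *ᵥ p +
      2 * ((x - p) ⬝ᵥ (diagonal (fun i => (π i)⁻¹) * (1 - P)) *ᵥ p) +
      (x - p) ⬝ᵥ (diagonal (fun i => (π i)⁻¹) * (1 - P)) *ᵥ (x - p) := by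
    conv_lhs => rw [← add_sub_cancel p x]
    rw [mulVec_add, add_dotProduct, dotProduct_add, dotProduct_add, hswap]
    ring
  rw [hquad, hsq]
  linear_combination hstationary (x - p)

/-- For a column-stochastic, time-reversible matrix `P`, the PageRank
objective `f` has a unique global minimizer over `ℝⁿ`, and this minimizer equals the
PageRank vector `p_o = γ (I − (1−γ)P)⁻¹ v`, the unique solution of `x = (1−γ)Px + γv`. -/
theorem stmt_0 (n : ℕ) (hn : 1 ≤ n)
    (P : Matrix (Fin n) (Fin n) ℝ)
    (hPnonneg : ∀ i j, 0 ≤ P i j) (hPcol : ∀ j, ∑ i, P i j = 1)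
    (π : Fin n → ℝ) (hπpos : ∀ i, 0 < π i) (hπsum : ∑ i, π i = 1)
    (hrev1 : P.mulVec π = π)
    (hrev2 : Pᵀ = Matrix.diagonal (fun i => (π i)⁻¹) * P * Matrix.diagonal π)
    (γ : ℝ) (hγ : γ ∈ Set.Ioo (0 : ℝ) 1)
    (v : Fin n → ℝ) (hv : ∀ i, 0 ≤ v i) (hvsum : ∑ i, v i = 1)
    (f : (Fin n → ℝ) → ℝ)
    (hf : ∀ x, f x =
      (1 / 2) * (1 - γ) *
        (x ⬝ᵥ (Matrix.diagonal (fun i => (π i)⁻¹) * (1 - P)).mulVec x)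
      + (γ / 2) * ∑ i, (x i - v i) ^ 2 / π i)
    (po : Fin n → ℝ) (hpo : po = γ • (1 - (1 - γ) • P)⁻¹.mulVec v) :
    (∀ x, f po ≤ f x) ∧
    (∀ x, (∀ z, f x ≤ f z) → x = po) ∧
    (po = (1 - γ) • P.mulVec po + γ • v) ∧
    (∀ x, x = (1 - γ) • P.mulVec x + γ • v → x = po) := by
  have hdet := isUnit_det_one_sub_smul hPnonneg hPcol hπpos hrev1 hγ
  have hsolve : po = (1 - γ) • P.mulVec po + γ • v := by
    have h : (1 - (1 - γ) • P) *ᵥ po = γ • v := by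
      rw [hpo, mulVec_smul, mulVec_mulVec, mul_nonsing_inv _ hdet, one_mulVec]
    rw [sub_mulVec, one_mulVec, smul_mulVec] at h
    rw [← h, add_sub_cancel]
  have hQ := dirichlet_form_nonneg hPnonneg hPcol hπpos hrev1
  have hgap : ∀ x, f po + (γ / 2) * ∑ i, (x - po) i ^ 2 / π i ≤ f x := by
    intro x
    rw [hf x, hf po, pagerank_objective_eq hπpos hrev2 hsolve x]
    nlinarith [mul_nonneg (sub_nonneg.2 hγ.2.le) (hQ (x - po))]
  refine ⟨fun x => ?_, fun x hx => ?_, hsolve, fun x hx => ?_⟩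
  · have hN : 0 ≤ ∑ i, (x - po) i ^ 2 / π i :=
      Finset.sum_nonneg fun i _ => div_nonneg (sq_nonneg _) (hπpos i).le
    nlinarith [hgap x, mul_nonneg hγ.1.le hN]
  · refine sub_eq_zero.1 (eq_zero_of_weighted_sq_nonpos hπpos ?_)
    nlinarith [hgap x, hx po, hγ.1]
  · have h : (1 - (1 - γ) • P) *ᵥ x = γ • v := by
      rw [sub_mulVec, one_mulVec, smul_mulVec, sub_eq_iff_eq_add']
      exact hx
    rw [hpo, ← mulVec_smul, ← h, mulVec_mulVec, nonsing_inv_mul _ hdet, one_mulVec]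
end

section
/- Let S₁,…,S_K be a partition of {1,…,n} into nonempty groups, let φ₁,…,φ_K ≥ 0 sum to 1, and let Δ_φ = { x ∈ ℝⁿ : x ≥ 0 and Σ_{i∈S_k} x_i = φ_k for every k }. Fix y ∈ ℝⁿ and suppose λ₁,…,λ_K ∈ ℝ satisfy Σ_{i∈S_k} max(0, y_i − λ_k) = φ_k for every k. Then the vector x* defined by x*_i = max(0, y_i − λ_k) for i ∈ S_k is the unique Euclidean projection of y onto Δ_φ, i.e. the unique minimizer of ‖x − y‖₂² over x ∈ Δ_φ. -/
open BigOperators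

/-- Sums over a finite type split along a family of finsets partitioning it. -/
theorem sum_eq_sum_sum_of_existsUnique_mem {ι κ M : Type*} [Fintype ι] [Fintype κ]
    [AddCommMonoid M] (S : κ → Finset ι) (hS : ∀ i, ∃! k, i ∈ S k) (f : ι → M) :
    ∑ i, f i = ∑ k, ∑ i ∈ S k, f i := by
  classical
  choose c hc hc_unique using hS
  rw [← Finset.sum_fiberwise Finset.univ c f]
  refine Finset.sum_congr rfl fun k _ => Finset.sum_congr ?_ fun _ _ => rfl
  ext i
  simp only [Finset.mem_filter, Finset.mem_univ, true_and]
  exact ⟨fun h => h ▸ hc i, fun h => (hc_unique i k h).symm⟩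

/-- The soft-thresholded value `max 0 (b - l)` minimizes `(a - b) ^ 2 + 2 * l * a` over `a ≥ 0`,
with quadratic growth. -/
theorem sq_sub_max_sub_le {a b l : ℝ} (ha : 0 ≤ a) :
    (a - max 0 (b - l)) ^ 2 ≤
      (a - b) ^ 2 - (max 0 (b - l) - b) ^ 2 + 2 * l * (a - max 0 (b - l)) := by
  rcases le_total 0 (b - l) with h | h
  · rw [max_eq_right h]
    exact le_of_eq (by ring)
  · rw [max_eq_left h]
    nlinarith [mul_nonneg ha (sub_nonneg.2 h)]

/-- Characterization of the Euclidean projection onto the φ-sum-fair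
set `Δ_φ`: if the dual variables `λ_k` satisfy the water-filling equations, then the
vector `x*_i = max(0, y_i − λ_k)` for `i ∈ S_k` is the unique Euclidean projection of
`y` onto `Δ_φ`. -/
theorem stmt_7 (n K : ℕ) (hn : 1 ≤ n) (hK : 1 ≤ K)
    (S : Fin K → Finset (Fin n)) (hSne : ∀ k, (S k).Nonempty)
    (hSpart : ∀ i, ∃! k, i ∈ S k)
    (φ : Fin K → ℝ) (hφ : ∀ k, 0 ≤ φ k) (hφsum : ∑ k, φ k = 1)
    (y : Fin n → ℝ) (lam : Fin K → ℝ)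
    (hlam : ∀ k, ∑ i ∈ S k, max 0 (y i - lam k) = φ k)
    (xstar : Fin n → ℝ)
    (hxstar : ∀ k, ∀ i ∈ S k, xstar i = max 0 (y i - lam k)) :
    ((∀ i, 0 ≤ xstar i) ∧ ∀ k, ∑ i ∈ S k, xstar i = φ k) ∧
    ∀ x : Fin n → ℝ, ((∀ i, 0 ≤ x i) ∧ ∀ k, ∑ i ∈ S k, x i = φ k) → x ≠ xstar →
      ∑ i, (xstar i - y i) ^ 2 < ∑ i, (x i - y i) ^ 2 := by
  have hsum : ∀ k, ∑ i ∈ S k, xstar i = φ k := fun k =>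
    (Finset.sum_congr rfl (hxstar k)).trans (hlam k)
  refine ⟨⟨fun i => ?_, hsum⟩, fun x ⟨hx, hxsum⟩ hne => ?_⟩
  · obtain ⟨k, hk, -⟩ := hSpart i
    rw [hxstar k i hk]
    exact le_max_left _ _
  have hgrowth : ∑ i, (x i - xstar i) ^ 2 ≤ ∑ i, ((x i - y i) ^ 2 - (xstar i - y i) ^ 2) := by
    rw [sum_eq_sum_sum_of_existsUnique_mem S hSpart,
      sum_eq_sum_sum_of_existsUnique_mem S hSpart]
    refine Finset.sum_le_sum fun k _ => ?_
    have hzero : ∑ i ∈ S k, 2 * lam k * (x i - xstar i) = 0 := by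
      rw [← Finset.mul_sum, Finset.sum_sub_distrib, hxsum, hsum, sub_self, mul_zero]
    rw [← add_zero (∑ i ∈ S k, ((x i - y i) ^ 2 - (xstar i - y i) ^ 2)), ← hzero,
      ← Finset.sum_add_distrib]
    refine Finset.sum_le_sum fun i hi => ?_
    rw [hxstar k i hi]
    exact sq_sub_max_sub_le (hx i)
  obtain ⟨j, hj⟩ := Function.ne_iff.1 hne
  have hpos : 0 < ∑ i, (x i - xstar i) ^ 2 :=
    Finset.sum_pos' (fun i _ => sq_nonneg _)
      ⟨j, Finset.mem_univ j, sq_pos_of_ne_zero (sub_ne_zero.2 hj)⟩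
  rw [Finset.sum_sub_distrib] at hgrowth
  linarith
end

section
/- Let S₁,…,S_K be a partition of {1,…,n} into nonempty groups, let A_k ⊆ S_k and α_k ≥ 0 for each k with Σ_k α_k|A_k| ≤ 1, and let Δ^α = { x ∈ ℝⁿ : x ≥ 0, Σ_i x_i = 1, and x_i ≥ α_k for every i ∈ A_k and every k }. Fix y ∈ ℝⁿ and suppose λ ∈ ℝ satisfies Σ_{k=1}^K [ Σ_{i∈A_k} max(α_k, y_i − λ) + Σ_{i∈S_k∖A_k} max(0, y_i − λ) ] = 1. Then the vector x* defined by x*_i = max(α_k, y_i − λ) for i ∈ A_k and x*_i = max(0, y_i − λ) for i ∈ S_k∖A_k is the unique Euclidean projection of y onto Δ^α. -/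
open BigOperators

/-- Summing over each block of a partition and then over the blocks is summing over everything. -/
theorem sum_sum_eq_sum_of_existsUnique_mem {ι κ M : Type*} [Fintype ι] [Fintype κ]
    [AddCommMonoid M] {S : κ → Finset ι} (hS : ∀ i, ∃! k, i ∈ S k) (f : ι → M) :
    ∑ k, ∑ i ∈ S k, f i = ∑ i, f i := by
  classical
  rw [Finset.sum_comm' (t' := Finset.univ) (s' := fun i => {k | i ∈ S k}) (by simp)]
  refine Finset.sum_congr rfl fun i _ => ?_
  obtain ⟨k, hk, huniq⟩ := hS i
  have : ({k | i ∈ S k} : Finset κ) = {k} := by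
    ext j
    simp only [Finset.mem_filter, Finset.mem_univ, true_and, Finset.mem_singleton]
    exact ⟨huniq j, fun h => h ▸ hk⟩
  rw [this, Finset.sum_singleton]

/-- The obtuse-angle inequality for the projection `max l c` of `c` onto `[l, ∞)`. -/
theorem sub_max_mul_max_sub_nonneg {l c x : ℝ} (hx : l ≤ x) :
    0 ≤ (x - max l c) * (max l c - c) := by
  rcases le_total l c with h | h
  · simp [max_eq_right h]
  · rw [max_eq_left h]
    exact mul_nonneg (sub_nonneg.2 hx) (sub_nonneg.2 h)

/-- Variational inequalities for the shifted point `y - c` give strict minimality of the squared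
distance to `y` among vectors with the same coordinate sum. -/
theorem sum_sq_sub_lt_sum_sq_sub {ι : Type*} [Fintype ι] {x z y : ι → ℝ} {c : ℝ}
    (hsum : ∑ i, x i = ∑ i, z i) (hvar : ∀ i, 0 ≤ (x i - z i) * (z i - (y i - c)))
    (hne : x ≠ z) : ∑ i, (z i - y i) ^ 2 < ∑ i, (x i - y i) ^ 2 := by
  obtain ⟨j, hj⟩ := Function.ne_iff.1 hne
  have hpos : 0 < ∑ i, (x i - z i) ^ 2 :=
    Finset.sum_pos' (fun i _ => sq_nonneg _)
      ⟨j, Finset.mem_univ j, sq_pos_of_ne_zero (sub_ne_zero.2 hj)⟩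
  have hnonneg : 0 ≤ ∑ i, (x i - z i) * (z i - (y i - c)) :=
    Finset.sum_nonneg fun i _ => hvar i
  have hexpand : ∑ i, (x i - y i) ^ 2 = ∑ i, (z i - y i) ^ 2 + ∑ i, (x i - z i) ^ 2 +
      2 * ∑ i, (x i - z i) * (z i - (y i - c)) - 2 * c * (∑ i, x i - ∑ i, z i) := by
    simp only [Finset.mul_sum, ← Finset.sum_add_distrib, ← Finset.sum_sub_distrib]
    exact Finset.sum_congr rfl fun i _ => by ring
  rw [hsum, sub_self] at hexpand
  linarith

/-- Characterization of the Euclidean projection onto the α-min-fair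
set `Δ^α`: if the dual variable `λ` satisfies the water-filling equation, then the
vector with `x*_i = max(α_k, y_i − λ)` on `A_k` and `x*_i = max(0, y_i − λ)` on
`S_k ∖ A_k` is the unique Euclidean projection of `y` onto `Δ^α`. -/
theorem stmt_8 (n K : ℕ) (hn : 1 ≤ n) (hK : 1 ≤ K)
    (S : Fin K → Finset (Fin n)) (hSne : ∀ k, (S k).Nonempty)
    (hSpart : ∀ i, ∃! k, i ∈ S k)
    (A : Fin K → Finset (Fin n)) (hA : ∀ k, A k ⊆ S k)
    (α : Fin K → ℝ) (hα : ∀ k, 0 ≤ α k)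
    (hfeas : ∑ k, α k * (A k).card ≤ 1)
    (y : Fin n → ℝ) (lam : ℝ)
    (hlam : ∑ k, ((∑ i ∈ A k, max (α k) (y i - lam)) +
      ∑ i ∈ S k \ A k, max 0 (y i - lam)) = 1)
    (xstar : Fin n → ℝ)
    (hx1 : ∀ k, ∀ i ∈ A k, xstar i = max (α k) (y i - lam))
    (hx2 : ∀ k, ∀ i ∈ S k \ A k, xstar i = max 0 (y i - lam)) :
    ((∀ i, 0 ≤ xstar i) ∧ (∑ i, xstar i = 1) ∧ ∀ k, ∀ i ∈ A k, α k ≤ xstar i) ∧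
    ∀ x : Fin n → ℝ,
      ((∀ i, 0 ≤ x i) ∧ (∑ i, x i = 1) ∧ ∀ k, ∀ i ∈ A k, α k ≤ x i) → x ≠ xstar →
      ∑ i, (xstar i - y i) ^ 2 < ∑ i, (x i - y i) ^ 2 := by
  have hcases : ∀ i, (∃ k, i ∈ A k) ∨ ∃ k, i ∈ S k \ A k := fun i => by
    obtain ⟨k, hk, -⟩ := hSpart i
    by_cases h : i ∈ A k
    · exact Or.inl ⟨k, h⟩
    · exact Or.inr ⟨k, Finset.mem_sdiff.2 ⟨hk, h⟩⟩
  have hsum : ∑ i, xstar i = 1 := by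
    rw [← sum_sum_eq_sum_of_existsUnique_mem hSpart, ← hlam]
    refine Finset.sum_congr rfl fun k _ => ?_
    rw [← Finset.sum_sdiff (hA k), add_comm, Finset.sum_congr rfl (hx1 k),
      Finset.sum_congr rfl (hx2 k)]
  refine ⟨⟨fun i => ?_, hsum, fun k i hi => hx1 k i hi ▸ le_max_left _ _⟩, ?_⟩
  · rcases hcases i with ⟨k, hi⟩ | ⟨k, hi⟩
    · exact hx1 k i hi ▸ (hα k).trans (le_max_left _ _)
    · exact hx2 k i hi ▸ le_max_left _ _
  · rintro x ⟨hx0, hxsum, hxA⟩ hne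
    refine sum_sq_sub_lt_sum_sq_sub (c := lam) (hxsum.trans hsum.symm) (fun i => ?_) hne
    rcases hcases i with ⟨k, hi⟩ | ⟨k, hi⟩
    · rw [hx1 k i hi]
      exact sub_max_mul_max_sub_nonneg (hxA k i hi)
    · rw [hx2 k i hi]
      exact sub_max_mul_max_sub_nonneg (hx0 i)
end

section
/- Let S₁,…,S_K be a partition of {1,…,n} into nonempty groups, let A_k ⊆ S_k, α_k ≥ 0 and φ_k ≥ 0 with Σ_k φ_k = 1 and α_k|A_k| ≤ φ_k for each k, and let Δ_φ^α = { x ∈ ℝⁿ : x ≥ 0, Σ_{i∈S_k} x_i = φ_k for every k, and x_i ≥ α_k for every i ∈ A_k and every k }. Fix y ∈ ℝⁿ and suppose λ₁,…,λ_K ∈ ℝ satisfy Σ_{i∈A_k} max(α_k, y_i − λ_k) + Σ_{i∈S_k∖A_k} max(0, y_i − λ_k) = φ_k for every k. Then the vector x* defined by x*_i = max(α_k, y_i − λ_k) for i ∈ A_k and x*_i = max(0, y_i − λ_k) for i ∈ S_k∖A_k is the unique Euclidean projection of y onto Δ_φ^α. -/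
open BigOperators

/-- Variational inequality for the projection of `t` onto the half-line `[a, ∞)`. -/
lemma mul_sub_max_nonneg {a t x : ℝ} (h : a ≤ x) :
    0 ≤ (x - max a t) * (max a t - t) := by
  rcases le_total a t with hat | hat
  · simp [max_eq_right hat]
  · rw [max_eq_left hat]
    exact mul_nonneg (sub_nonneg.2 h) (sub_nonneg.2 hat)

/-- A weighted sum vanishes when the weights are constant on the blocks of a partition and the
summand has zero sum over each block. -/
lemma sum_mul_eq_zero_of_sum_block_eq_zero {ι κ : Type*} [Fintype ι] [Fintype κ]
    [DecidableEq κ] (S : κ → Finset ι) (p : ι → κ) (hp : ∀ i k, i ∈ S k ↔ p i = k)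
    (c : κ → ℝ) (d : ι → ℝ) (hd : ∀ k, ∑ i ∈ S k, d i = 0) :
    ∑ i, c (p i) * d i = 0 := by
  rw [← Finset.sum_fiberwise Finset.univ p]
  refine Finset.sum_eq_zero fun k _ => ?_
  have hS : Finset.univ.filter (fun i => p i = k) = S k := by
    ext i
    simp [hp]
  rw [hS, ← mul_zero (c k), ← hd k, Finset.mul_sum]
  exact Finset.sum_congr rfl fun i hi => by rw [(hp i k).1 hi]

/-- Characterization of the Euclidean projection onto the combined
φ-sum + α-min-fair set `Δ_φ^α`: if the per-group dual variables `λ_k` satisfy the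
water-filling equations, then the vector with `x*_i = max(α_k, y_i − λ_k)` on `A_k`
and `x*_i = max(0, y_i − λ_k)` on `S_k ∖ A_k` is the unique Euclidean projection of
`y` onto `Δ_φ^α`. -/
theorem stmt_9 (n K : ℕ) (hn : 1 ≤ n) (hK : 1 ≤ K)
    (S : Fin K → Finset (Fin n)) (hSne : ∀ k, (S k).Nonempty)
    (hSpart : ∀ i, ∃! k, i ∈ S k)
    (A : Fin K → Finset (Fin n)) (hA : ∀ k, A k ⊆ S k)
    (α : Fin K → ℝ) (hα : ∀ k, 0 ≤ α k)
    (φ : Fin K → ℝ) (hφ : ∀ k, 0 ≤ φ k) (hφsum : ∑ k, φ k = 1)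
    (hfeas : ∀ k, α k * (A k).card ≤ φ k)
    (y : Fin n → ℝ) (lam : Fin K → ℝ)
    (hlam : ∀ k, (∑ i ∈ A k, max (α k) (y i - lam k)) +
      (∑ i ∈ S k \ A k, max 0 (y i - lam k)) = φ k)
    (xstar : Fin n → ℝ)
    (hx1 : ∀ k, ∀ i ∈ A k, xstar i = max (α k) (y i - lam k))
    (hx2 : ∀ k, ∀ i ∈ S k \ A k, xstar i = max 0 (y i - lam k)) :
    ((∀ i, 0 ≤ xstar i) ∧ (∀ k, ∑ i ∈ S k, xstar i = φ k) ∧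
      ∀ k, ∀ i ∈ A k, α k ≤ xstar i) ∧
    ∀ x : Fin n → ℝ,
      ((∀ i, 0 ≤ x i) ∧ (∀ k, ∑ i ∈ S k, x i = φ k) ∧ ∀ k, ∀ i ∈ A k, α k ≤ x i) →
      x ≠ xstar →
      ∑ i, (xstar i - y i) ^ 2 < ∑ i, (x i - y i) ^ 2 := by
  choose p hpS hpu using hSpart
  have hp : ∀ i k, i ∈ S k ↔ p i = k := fun i k =>
    ⟨fun h => (hpu i k h).symm, fun h => h ▸ hpS i⟩
  have hsum : ∀ k, ∑ i ∈ S k, xstar i = φ k := fun k => by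
    rw [← hlam k, ← Finset.sum_sdiff (hA k), add_comm, Finset.sum_congr rfl (hx1 k),
      Finset.sum_congr rfl (hx2 k)]
  refine ⟨⟨fun i => ?_, hsum, fun k i hi => hx1 k i hi ▸ le_max_left _ _⟩, ?_⟩
  · by_cases hi : i ∈ A (p i)
    · exact hx1 _ i hi ▸ (hα _).trans (le_max_left _ _)
    · exact hx2 _ i (Finset.mem_sdiff.2 ⟨hpS i, hi⟩) ▸ le_max_left _ _
  rintro x ⟨hx0, hxs, hxA⟩ hne
  have hvar : ∀ i, 0 ≤ (x i - xstar i) * (xstar i - (y i - lam (p i))) := fun i => by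
    by_cases hi : i ∈ A (p i)
    · rw [hx1 _ i hi]
      exact mul_sub_max_nonneg (hxA _ i hi)
    · rw [hx2 _ i (Finset.mem_sdiff.2 ⟨hpS i, hi⟩)]
      exact mul_sub_max_nonneg (hx0 i)
  have hzero : ∑ i, lam (p i) * (x i - xstar i) = 0 :=
    sum_mul_eq_zero_of_sum_block_eq_zero S p hp lam (fun i => x i - xstar i) fun k => by
      rw [Finset.sum_sub_distrib, hxs, hsum, sub_self]
  obtain ⟨j, hj⟩ := Function.ne_iff.1 hne
  have hpos : 0 < ∑ i, (x i - xstar i) ^ 2 :=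
    Finset.sum_pos' (fun i _ => sq_nonneg _)
      ⟨j, Finset.mem_univ j, sq_pos_of_ne_zero (sub_ne_zero.2 hj)⟩
  have hle : ∑ i, ((xstar i - y i) ^ 2 + (x i - xstar i) ^ 2
      - 2 * (lam (p i) * (x i - xstar i))) ≤ ∑ i, (x i - y i) ^ 2 :=
    Finset.sum_le_sum fun i _ => by linarith [hvar i]
  rw [Finset.sum_sub_distrib, Finset.sum_add_distrib, ← Finset.mul_sum, hzero] at hle
  linarith
end

section
/- Let {1,…,n} = S₁ ∪ S₂ be a partition into two nonempty groups, let φ ∈ (0,1), and let Δ = { x ≥ 0 : Σ_{i∈S₁} x_i = φ, Σ_{i∈S₂} x_i = 1−φ }. Let p ∈ ℝⁿ be entrywise nonnegative with Σ_i p_i = 1, set φ_o = Σ_{i∈S₁} p_i and ε = φ − φ_o, and assume ε ≥ 0. Suppose S₂⁺ ⊆ S₂ is nonempty, S₂⁻ = S₂ ∖ S₂⁺, c = Σ_{i∈S₂⁻} p_i, λ = (ε − c)/|S₂⁺|, and S₂⁺ = { i ∈ S₂ : p_i ≥ λ }. Then the unique Euclidean projection of p onto Δ is the vector x* given by x*_i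 = p_i + ε/|S₁| for i ∈ S₁, x*_i = p_i − λ for i ∈ S₂⁺, and x*_i = 0 for i ∈ S₂⁻. -/
open BigOperators

/-- The variational inequality at `y` makes `y` strictly closer to `p` than any other `x`. -/
theorem sum_sq_sub_lt_of_inner_nonneg {ι : Type*} [Fintype ι] {p x y : ι → ℝ}
    (h : 0 ≤ ∑ i, (x i - y i) * (y i - p i)) (hxy : x ≠ y) :
    ∑ i, (y i - p i) ^ 2 < ∑ i, (x i - p i) ^ 2 := by
  obtain ⟨j, hj⟩ := Function.ne_iff.mp hxy
  have hpos : 0 < ∑ i, (x i - y i) ^ 2 :=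
    Finset.sum_pos' (fun i _ => sq_nonneg _)
      ⟨j, Finset.mem_univ j, by have := sub_ne_zero.mpr hj; positivity⟩
  have hexp : ∑ i, (x i - p i) ^ 2 = ∑ i, (x i - y i) ^ 2
      + 2 * ∑ i, (x i - y i) * (y i - p i) + ∑ i, (y i - p i) ^ 2 := by
    rw [Finset.mul_sum, ← Finset.sum_add_distrib, ← Finset.sum_add_distrib]
    exact Finset.sum_congr rfl fun i _ => by ring
  linarith

/-- Semi-analytical form of the Euclidean projection of a PageRank
vector `p` onto the two-group φ-sum-fair set: under the stated self-consistency
conditions on `S₂⁺`, `c` and `λ`, the vector with `x*_i = p_i + ε/|S₁|` on `S₁`,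
`x*_i = p_i − λ` on `S₂⁺` and `x*_i = 0` on `S₂⁻` is the unique Euclidean projection
of `p` onto `Δ`. -/
theorem stmt_15 (n : ℕ) (hn : 1 ≤ n)
    (S1 S2 : Finset (Fin n)) (hS1 : S1.Nonempty) (hS2 : S2.Nonempty)
    (hdisj : Disjoint S1 S2) (hunion : S1 ∪ S2 = Finset.univ)
    (φ : ℝ) (hφ : φ ∈ Set.Ioo (0 : ℝ) 1)
    (p : Fin n → ℝ) (hp : ∀ i, 0 ≤ p i) (hpsum : ∑ i, p i = 1)
    (φo ε : ℝ) (hφo : φo = ∑ i ∈ S1, p i) (hε : ε = φ - φo) (hεnn : 0 ≤ ε)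
    (S2p : Finset (Fin n)) (hS2psub : S2p ⊆ S2) (hS2pne : S2p.Nonempty)
    (c lam : ℝ) (hc : c = ∑ i ∈ S2 \ S2p, p i) (hlam : lam = (ε - c) / S2p.card)
    (hS2pdef : S2p = S2.filter (fun i => lam ≤ p i))
    (xstar : Fin n → ℝ)
    (hx1 : ∀ i ∈ S1, xstar i = p i + ε / S1.card)
    (hx2 : ∀ i ∈ S2p, xstar i = p i - lam)
    (hx3 : ∀ i ∈ S2 \ S2p, xstar i = 0) :
    ((∀ i, 0 ≤ xstar i) ∧ (∑ i ∈ S1, xstar i = φ) ∧ (∑ i ∈ S2, xstar i = 1 - φ)) ∧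
    ∀ x : Fin n → ℝ,
      ((∀ i, 0 ≤ x i) ∧ (∑ i ∈ S1, x i = φ) ∧ (∑ i ∈ S2, x i = 1 - φ)) → x ≠ xstar →
      ∑ i, (xstar i - p i) ^ 2 < ∑ i, (x i - p i) ^ 2 := by
  have hsplit (f : Fin n → ℝ) : ∑ i, f i = ∑ i ∈ S1, f i + ∑ i ∈ S2, f i := by
    rw [← hunion, Finset.sum_union hdisj]
  have hcard1 : (S1.card : ℝ) ≠ 0 := by exact_mod_cast hS1.card_pos.ne'
  have hcard2 : (S2p.card : ℝ) ≠ 0 := by exact_mod_cast hS2pne.card_pos.ne'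
  have hge : ∀ i ∈ S2p, lam ≤ p i := fun i hi => by
    rw [hS2pdef] at hi
    exact (Finset.mem_filter.mp hi).2
  have hlt : ∀ i ∈ S2 \ S2p, p i < lam := fun i hi => by
    obtain ⟨hi2, hip⟩ := Finset.mem_sdiff.mp hi
    by_contra! hle
    exact hip (hS2pdef ▸ Finset.mem_filter.mpr ⟨hi2, hle⟩)
  have hcases : ∀ i ∈ S2, i ∈ S2p ∨ i ∈ S2 \ S2p := fun i hi => by
    rw [Finset.mem_sdiff]
    tauto
  have hsum1 : ∑ i ∈ S1, xstar i = φ := by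
    rw [Finset.sum_congr rfl hx1, Finset.sum_add_distrib, Finset.sum_const, nsmul_eq_mul,
      mul_div_cancel₀ _ hcard1]
    linarith
  have hsum2 : ∑ i ∈ S2, xstar i = 1 - φ := by
    have hp2 := Finset.sum_sdiff (f := p) hS2psub
    have hmul : (S2p.card : ℝ) * lam = ε - c := by rw [hlam, mul_div_cancel₀ _ hcard2]
    have hp12 := hsplit p
    rw [← Finset.sum_sdiff hS2psub, Finset.sum_eq_zero hx3, Finset.sum_congr rfl hx2,
      Finset.sum_sub_distrib, Finset.sum_const, nsmul_eq_mul]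
    linarith
  refine ⟨⟨fun i => ?_, hsum1, hsum2⟩, ?_⟩
  · rcases Finset.mem_union.mp (hunion ▸ Finset.mem_univ i) with hi | hi
    · rw [hx1 i hi]
      exact add_nonneg (hp i) (div_nonneg hεnn (Nat.cast_nonneg _))
    · rcases hcases i hi with hi | hi
      · rw [hx2 i hi]
        exact sub_nonneg.mpr (hge i hi)
      · exact (hx3 i hi).ge
  · rintro x ⟨hx, hxs1, hxs2⟩ hne
    refine sum_sq_sub_lt_of_inner_nonneg ?_ hne
    have h1 : ∑ i ∈ S1, (x i - xstar i) * (xstar i - p i) = 0 := by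
      have : ∀ i ∈ S1, (x i - xstar i) * (xstar i - p i)
          = (x i - xstar i) * (ε / S1.card) := fun i hi => by
        rw [hx1 i hi]
        ring
      rw [Finset.sum_congr rfl this, ← Finset.sum_mul, Finset.sum_sub_distrib, hxs1, hsum1,
        sub_self, zero_mul]
    have h2 : ∑ i ∈ S2, (x i - xstar i) * (-lam)
        ≤ ∑ i ∈ S2, (x i - xstar i) * (xstar i - p i) := by
      refine Finset.sum_le_sum fun i hi => ?_
      rcases hcases i hi with hi | hi
      · rw [hx2 i hi]
        exact le_of_eq (by ring)
      · rw [hx3 i hi]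
        nlinarith [mul_nonneg (hx i) (sub_nonneg.mpr (hlt i hi).le)]
    rw [← Finset.sum_mul, Finset.sum_sub_distrib, hxs2, hsum2, sub_self, zero_mul] at h2
    rw [hsplit, h1, zero_add]
    exact h2
end
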